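/- arXiv:1612.02615 — 2 statements merged into one kernel-verified Lean document; each statement's English description precedes it below -/
import Mathlib

section
/- Let a₁, a₂, a₃ > 0, β ∈ [0, π], μ > 0 with μ ≠ 1, and let ω > 0 satisfy sin(ω aᵢ) ≠ 0 for i = 1, 2, 3. Assume φ_β(ω) − f(ξ, η, ω) ≠ 0 for all (ξ, η) ∈ [0, 2π]². Then there exists a square-summable u : ℤ² → ℂ, not identically zero, satisfying the system (FD), if and only if (1 − μ) I_β(ω) = 1, i.e. μ = 1 − F_β(ω). -/
open Real MeasureTheory Set Filter Topology

noncomputable section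

/-- The dispersion relation `D_β(ω, k₁, k₂)`. -/
def Dfun (a₁ a₂ a₃ β ω k₁ k₂ : ℝ) : ℝ :=
  Real.sin (ω * a₂) * Real.sin (ω * a₃) * (Real.cos (ω * a₁) - Real.cos k₁)
    + Real.sin (ω * a₃) * Real.sin (ω * a₁) * (Real.cos (ω * a₂) - Real.cos k₂)
    + Real.sin (ω * a₁) * Real.sin (ω * a₂) * (Real.cos (ω * a₃) - Real.cos β)

/-- The dispersion set `Σ(β)`. -/
def dispSet (a₁ a₂ a₃ β : ℝ) : Set ℝ :=
  {ω | 0 < ω ∧ ∃ k₁ ∈ Icc (0 : ℝ) π, ∃ k₂ ∈ Icc (0 : ℝ) π, Dfun a₁ a₂ a₃ β ω k₁ k₂ = 0}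

/-- `φ_β(ω) = (cos(ω a₃) − cos β)/sin(ω a₃)`. -/
def phiB (a₃ β ω : ℝ) : ℝ := (Real.cos (ω * a₃) - Real.cos β) / Real.sin (ω * a₃)

/-- `f(ξ, η, ω)`. -/
def fFun (a₁ a₂ ξ η ω : ℝ) : ℝ :=
  (Real.cos ξ - Real.cos (ω * a₁)) / Real.sin (ω * a₁)
    + (Real.cos η - Real.cos (ω * a₂)) / Real.sin (ω * a₂)

/-- `g_β(ω)`. -/
def gB (a₁ a₂ a₃ β ω : ℝ) : ℝ :=
  Real.cos (ω * a₁) / Real.sin (ω * a₁) + Real.cos (ω * a₂) / Real.sin (ω * a₂)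
    + phiB a₃ β ω

/-- The set `T = {πn/a₁ : n ≥ 1} ∪ {πn/a₂ : n ≥ 1}`. -/
def Tset (a₁ a₂ : ℝ) : Set ℝ :=
  {x | ∃ n : ℕ, 1 ≤ n ∧ x = π * n / a₁} ∪ {x | ∃ n : ℕ, 1 ≤ n ∧ x = π * n / a₂}

/-- The set `𝒲(β)`. -/
def Wset (a₃ β : ℝ) : Set ℝ :=
  if β = 0 ∨ β = π then
    {x | ∃ n : ℕ, 1 ≤ n ∧ x = β / a₃ + (2 * n + 1) * π / a₃}
  else
    {x | ∃ n : ℕ, 1 ≤ n ∧ x = π * n / a₃}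

/-- `(ω_b, ω_t)` is a gap of the dispersion set `Σ(β)`. -/
def IsGap (a₁ a₂ a₃ β ωb ωt : ℝ) : Prop :=
  0 < ωb ∧ ωb < ωt ∧ ωb ∈ dispSet a₁ a₂ a₃ β ∧ ωt ∈ dispSet a₁ a₂ a₃ β ∧
    Ioo ωb ωt ∩ dispSet a₁ a₂ a₃ β = ∅

/-- The finite-difference system (FD). -/
def SatisfiesFD (a₁ a₂ a₃ β μ ω : ℝ) (u : ℤ × ℤ → ℂ) : Prop :=
  (∀ k ℓ : ℤ, (k, ℓ) ≠ ((0 : ℤ), (0 : ℤ)) →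
    u (k + 1, ℓ) / (Real.sin (ω * a₁) : ℂ) + u (k - 1, ℓ) / (Real.sin (ω * a₁) : ℂ)
      + u (k, ℓ + 1) / (Real.sin (ω * a₂) : ℂ) + u (k, ℓ - 1) / (Real.sin (ω * a₂) : ℂ)
      - 2 * (gB a₁ a₂ a₃ β ω : ℂ) * u (k, ℓ) = 0)
  ∧ u (1, 0) / (Real.sin (ω * a₁) : ℂ) + u (-1, 0) / (Real.sin (ω * a₁) : ℂ)
      + u (0, 1) / (Real.sin (ω * a₂) : ℂ) + u (0, -1) / (Real.sin (ω * a₂) : ℂ)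
      - 2 * (gB a₁ a₂ a₃ β ω : ℂ) * u (0, 0)
      = 2 * ((μ - 1 : ℝ) : ℂ) * (phiB a₃ β ω : ℂ) * u (0, 0)

/-- `I_β(ω) = (1/(4π²)) ∫_{(0,2π)²} φ_β(ω)/(φ_β(ω) − f(ξ,η,ω)) dξ dη`. -/
def IB (a₁ a₂ a₃ β ω : ℝ) : ℝ :=
  (1 / (4 * π ^ 2)) *
    ∫ p in (Ioo (0 : ℝ) (2 * π)) ×ˢ (Ioo (0 : ℝ) (2 * π)),
      phiB a₃ β ω / (phiB a₃ β ω - fFun a₁ a₂ p.1 p.2 ω)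

/-- `F_β(ω) = I_β(ω)⁻¹`. -/
def FB (a₁ a₂ a₃ β ω : ℝ) : ℝ := (IB a₁ a₂ a₃ β ω)⁻¹

/-- The anisotropic discrete Laplacian on `ℤ²` with hopping weights `a`, `b` and potential `-c`. -/
def latticeOp (a b c : ℂ) (u : ℤ × ℤ → ℂ) (q : ℤ × ℤ) : ℂ :=
  a * (u (q + (1, 0)) + u (q + (-1, 0))) + b * (u (q + (0, 1)) + u (q + (0, -1))) - c * u q

lemma summable_shift_mul {u v : ℤ × ℤ → ℂ} (hu : Summable fun p => ‖u p‖ ^ 2)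
    (hv : Summable fun p => ‖v p‖ ^ 2) (d : ℤ × ℤ) : Summable fun q => u (q + d) * v q := by
  have hu' : Summable fun q => ‖u (q + d)‖ ^ 2 := (Equiv.addRight d).summable_iff.mpr hu
  refine Summable.of_norm_bounded (hu'.add hv) fun q => ?_
  rw [norm_mul]
  nlinarith [sq_nonneg (‖u (q + d)‖ - ‖v q‖), sq_nonneg ‖u (q + d)‖, sq_nonneg ‖v q‖]

lemma tsum_shift_mul (u v : ℤ × ℤ → ℂ) {d e : ℤ × ℤ} (h : e + d = 0) :
    ∑' q, u (q + d) * v q = ∑' q, v (q + e) * u q := by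
  rw [← (Equiv.addRight e).tsum_eq fun q => u (q + d) * v q]
  simp [add_assoc, h, mul_comm]

lemma tsum_latticeOp_mul (a b c : ℂ) {u v : ℤ × ℤ → ℂ} (hu : Summable fun p => ‖u p‖ ^ 2)
    (hv : Summable fun p => ‖v p‖ ^ 2) :
    ∑' q, latticeOp a b c u q * v q =
      a * (∑' q, u (q + (1, 0)) * v q + ∑' q, u (q + (-1, 0)) * v q)
        + b * (∑' q, u (q + (0, 1)) * v q + ∑' q, u (q + (0, -1)) * v q)
        - c * ∑' q, u q * v q := by
  have H := fun d => (summable_shift_mul hu hv d).hasSum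
  have H0 : HasSum (fun q => u q * v q) (∑' q, u q * v q) := by simpa using H 0
  rw [← ((((H (1, 0)).add (H (-1, 0))).mul_left a).add
    (((H (0, 1)).add (H (0, -1))).mul_left b) |>.sub (H0.mul_left c)).tsum_eq]
  exact tsum_congr fun q => by simp only [latticeOp]; ring

lemma tsum_latticeOp_mul_comm (a b c : ℂ) {u v : ℤ × ℤ → ℂ} (hu : Summable fun p => ‖u p‖ ^ 2)
    (hv : Summable fun p => ‖v p‖ ^ 2) :
    ∑' q, latticeOp a b c u q * v q = ∑' q, latticeOp a b c v q * u q := by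
  rw [tsum_latticeOp_mul a b c hu hv, tsum_latticeOp_mul a b c hv hu,
    tsum_shift_mul u v (d := (1, 0)) (e := (-1, 0)) (by simp),
    tsum_shift_mul u v (d := (-1, 0)) (e := (1, 0)) (by simp),
    tsum_shift_mul u v (d := (0, 1)) (e := (0, -1)) (by simp),
    tsum_shift_mul u v (d := (0, -1)) (e := (0, 1)) (by simp)]
  simp_rw [mul_comm (u _) (v _)]
  ring

/-- A square-summable solution with a point source is a multiple of the square-summable
Green's function. -/
lemma eq_mul_of_latticeOp_eq_single {a b c s : ℂ} {u G : ℤ × ℤ → ℂ}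
    (hu : Summable fun p => ‖u p‖ ^ 2) (hG : Summable fun p => ‖G p‖ ^ 2)
    (hGop : latticeOp a b c G = Pi.single 0 1) (huop : latticeOp a b c u = Pi.single 0 s)
    (p : ℤ × ℤ) : u p = s * G (-p) := by
  have hK : Summable fun q => ‖G (q - p)‖ ^ 2 := (Equiv.subRight p).summable_iff.mpr hG
  have hKop : latticeOp a b c (fun q => G (q - p)) = Pi.single p 1 := by
    funext q
    have h := congrFun hGop (q - p)
    simp only [latticeOp] at h ⊢
    simp only [add_sub_right_comm, h, Pi.single_apply, sub_eq_zero]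
  have h := tsum_latticeOp_mul_comm a b c hu hK
  rw [huop, hKop, tsum_eq_single 0, tsum_eq_single p] at h
  · simpa using h.symm
  · intro q hq
    simp [hq]
  · intro q hq
    simp [hq]

/-- The open square `(0, 2π)²`. -/
def fourierSquare : Set (ℝ × ℝ) := Ioo 0 (2 * π) ×ˢ Ioo 0 (2 * π)

/-- The character `exp (i (k ξ + ℓ η))`. -/
def squareChar (n : ℤ × ℤ) (p : ℝ × ℝ) : ℂ :=
  Complex.exp (n.1 * p.1 * Complex.I) * Complex.exp (n.2 * p.2 * Complex.I)

lemma continuous_squareChar (n : ℤ × ℤ) : Continuous (squareChar n) := by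
  unfold squareChar
  fun_prop

lemma norm_squareChar (n : ℤ × ℤ) (p : ℝ × ℝ) : ‖squareChar n p‖ = 1 := by
  have h (k : ℤ) (x : ℝ) : ‖Complex.exp (k * x * Complex.I)‖ = 1 := by
    rw [← Complex.norm_exp_ofReal_mul_I (k * x)]
    push_cast
    rfl
  rw [squareChar, norm_mul, h, h, one_mul]

lemma squareChar_add (m n : ℤ × ℤ) (p : ℝ × ℝ) :
    squareChar (m + n) p = squareChar m p * squareChar n p := by
  simp only [squareChar, Prod.fst_add, Prod.snd_add, Int.cast_add, add_mul, Complex.exp_add]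
  ring

lemma conj_squareChar (n : ℤ × ℤ) (p : ℝ × ℝ) :
    starRingEnd ℂ (squareChar n p) = squareChar (-n) p := by
  simp [squareChar, ← Complex.exp_conj]

lemma integral_exp_int_mul (k : ℤ) :
    ∫ x in Ioo 0 (2 * π), Complex.exp (k * (x : ℝ) * Complex.I) =
      if k = 0 then (2 * π : ℂ) else 0 := by
  rw [← integral_Ioc_eq_integral_Ioo, ← intervalIntegral.integral_of_le (by positivity)]
  split_ifs with hk
  · simp [hk]
  · have hc : (k : ℂ) * Complex.I ≠ 0 := by simp [hk]
    have h (x : ℝ) : (k : ℂ) * x * Complex.I = k * Complex.I * x := by ring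
    simp_rw [h]
    rw [integral_exp_mul_complex hc]
    have h2 : (k : ℂ) * Complex.I * ((2 * π : ℝ) : ℂ) = k * (2 * π * Complex.I) := by
      push_cast; ring
    rw [h2, Complex.exp_int_mul_two_pi_mul_I]
    simp

lemma integral_squareChar (n : ℤ × ℤ) :
    ∫ p in fourierSquare, squareChar n p = if n = 0 then (4 * π ^ 2 : ℂ) else 0 := by
  have h := setIntegral_prod_mul (μ := (volume : Measure ℝ)) (ν := (volume : Measure ℝ))
    (fun x : ℝ => Complex.exp (n.1 * x * Complex.I))
    (fun x : ℝ => Complex.exp (n.2 * x * Complex.I)) (Ioo 0 (2 * π)) (Ioo 0 (2 * π))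
  rw [integral_exp_int_mul, integral_exp_int_mul] at h
  refine Eq.trans h ?_
  by_cases h1 : n.1 = 0 <;> by_cases h2 : n.2 = 0 <;> simp [h1, h2, Prod.ext_iff]
  ring

instance : IsFiniteMeasure (volume.restrict fourierSquare) :=
  ⟨by
    rw [Measure.restrict_apply_univ]
    exact (measure_mono (Set.prod_mono Ioo_subset_Icc_self Ioo_subset_Icc_self)).trans_lt
      (isCompact_Icc.prod isCompact_Icc).measure_lt_top⟩

lemma memLp_squareChar (n : ℤ × ℤ) : MemLp (squareChar n) 2 (volume.restrict fourierSquare) :=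
  MemLp.of_bound (continuous_squareChar n).aestronglyMeasurable 1
    (Eventually.of_forall fun p => (norm_squareChar n p).le)

/-- Bessel's inequality for the Fourier coefficients on the square. -/
lemma summable_sq_fourierCoeff {h : ℝ × ℝ → ℂ} (hh : MemLp h 2 (volume.restrict fourierSquare)) :
    Summable fun n => ‖∫ p in fourierSquare, squareChar n p * h p‖ ^ 2 := by
  have hin (n : ℤ × ℤ) {g : ℝ × ℝ → ℂ} (hg : MemLp g 2 (volume.restrict fourierSquare)) :
      inner ℂ (memLp_squareChar n).toLp hg.toLp = ∫ p in fourierSquare, squareChar (-n) p * g p := by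
    rw [L2.inner_def]
    refine integral_congr_ae ?_
    filter_upwards [(memLp_squareChar n).coeFn_toLp, hg.coeFn_toLp] with p h1 h2
    rw [h1, h2, RCLike.inner_apply, conj_squareChar, mul_comm]
  have hpi : (2 * π : ℂ) ≠ 0 := by simp [pi_ne_zero]
  have hon : Orthonormal ℂ fun n => (2 * π : ℂ)⁻¹ • (memLp_squareChar n).toLp := by
    rw [orthonormal_iff_ite]
    intro m n
    rw [inner_smul_left, inner_smul_right, hin]
    simp_rw [← squareChar_add, integral_squareChar, neg_add_eq_zero]
    split_ifs
    · simp only [map_inv₀, map_mul, Complex.conj_ofReal, map_ofNat]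
      field_simp
      ring
    · simp
  have hs := hon.inner_products_summable (x := hh.toLp)
  have hs' := ((Equiv.neg _).summable_iff.mpr hs).mul_left ((2 * π) ^ 2)
  refine hs'.congr fun n => ?_
  simp only [Function.comp, Equiv.neg_apply, inner_smul_left, hin, neg_neg, norm_mul, mul_pow]
  simp [abs_of_pos pi_pos]
  field_simp

/-- The symbol of `latticeOp a b c`. -/
def latticeSymbol (a b c : ℝ) (p : ℝ × ℝ) : ℝ := 2 * a * cos p.1 + 2 * b * cos p.2 - c

/-- The Green's function of `latticeOp a b c`. -/
def latticeGreen (a b c : ℝ) (n : ℤ × ℤ) : ℂ :=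
  (4 * π ^ 2 : ℂ)⁻¹ * ∫ p in fourierSquare, squareChar n p * ((latticeSymbol a b c p)⁻¹ : ℝ)

lemma memLp_inv_latticeSymbol {a b c : ℝ}
    (h : ∀ ξ ∈ Icc (0 : ℝ) (2 * π), ∀ η ∈ Icc (0 : ℝ) (2 * π), latticeSymbol a b c (ξ, η) ≠ 0) :
    MemLp (fun p => (((latticeSymbol a b c p)⁻¹ : ℝ) : ℂ)) 2 (volume.restrict fourierSquare) := by
  have hc : Continuous (latticeSymbol a b c) := by unfold latticeSymbol; fun_prop
  have hci : ContinuousOn (fun p => (((latticeSymbol a b c p)⁻¹ : ℝ) : ℂ))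
      (Icc 0 (2 * π) ×ˢ Icc 0 (2 * π)) :=
    Complex.continuous_ofReal.comp_continuousOn
      (hc.continuousOn.inv₀ fun p hp => h p.1 hp.1 p.2 hp.2)
  obtain ⟨C, hC⟩ := (isCompact_Icc.prod isCompact_Icc).exists_bound_of_continuousOn hci
  refine MemLp.of_bound
    (Complex.measurable_ofReal.comp hc.measurable.inv).aestronglyMeasurable C ?_
  filter_upwards [ae_restrict_mem (measurableSet_Ioo.prod measurableSet_Ioo)] with p hp
  exact hC p (Set.prod_mono Ioo_subset_Icc_self Ioo_subset_Icc_self hp)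

lemma summable_sq_latticeGreen {a b c : ℝ}
    (h : ∀ ξ ∈ Icc (0 : ℝ) (2 * π), ∀ η ∈ Icc (0 : ℝ) (2 * π), latticeSymbol a b c (ξ, η) ≠ 0) :
    Summable fun n => ‖latticeGreen a b c n‖ ^ 2 := by
  simp only [latticeGreen, norm_mul, mul_pow]
  exact (summable_sq_fourierCoeff (memLp_inv_latticeSymbol h)).mul_left _

lemma latticeOp_squareChar (a b c : ℝ) (n : ℤ × ℤ) (p : ℝ × ℝ) :
    latticeOp a b c (fun m => squareChar m p) n = squareChar n p * latticeSymbol a b c p := by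
  simp only [latticeOp, squareChar_add, latticeSymbol]
  push_cast
  rw [Complex.cos, Complex.cos]
  simp [squareChar]
  ring

lemma latticeOp_latticeGreen {a b c : ℝ}
    (h : ∀ ξ ∈ Icc (0 : ℝ) (2 * π), ∀ η ∈ Icc (0 : ℝ) (2 * π), latticeSymbol a b c (ξ, η) ≠ 0) :
    latticeOp a b c (latticeGreen a b c) = Pi.single 0 1 := by
  funext n
  have hint (m : ℤ × ℤ) : IntegrableOn
      (fun p => squareChar m p * ((latticeSymbol a b c p)⁻¹ : ℝ)) fourierSquare :=
    (memLp_squareChar m).integrable_mul (memLp_inv_latticeSymbol h)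
  have hop : latticeOp a b c (latticeGreen a b c) n = (4 * π ^ 2 : ℂ)⁻¹ *
      ∫ p in fourierSquare, latticeOp a b c (fun m => squareChar m p) n *
        ((latticeSymbol a b c p)⁻¹ : ℝ) := by
    simp only [latticeOp, latticeGreen, add_mul, sub_mul, mul_add, mul_assoc]
    rw [integral_sub, integral_add, integral_add, integral_add]
    · simp only [integral_const_mul]
      ring
    all_goals
      repeat' first
        | exact (hint _).const_mul _
        | apply Integrable.add
  rw [hop]
  have hcancel : ∫ p in fourierSquare, latticeOp a b c (fun m => squareChar m p) n *
        ((latticeSymbol a b c p)⁻¹ : ℝ) = ∫ p in fourierSquare, squareChar n p := by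
    refine setIntegral_congr_fun (measurableSet_Ioo.prod measurableSet_Ioo) fun p hp => ?_
    have hp' : (latticeSymbol a b c p : ℂ) ≠ 0 := Complex.ofReal_ne_zero.mpr
      (h p.1 (Ioo_subset_Icc_self hp.1) p.2 (Ioo_subset_Icc_self hp.2))
    simp only [latticeOp_squareChar]
    push_cast
    field_simp
  rw [hcancel, integral_squareChar, Pi.single_apply]
  have hpi : (π : ℂ) ≠ 0 := by simp [pi_ne_zero]
  split_ifs
  · field_simp
  · simp

lemma latticeSymbol_eq {a₁ a₂ a₃ β ω : ℝ} (p : ℝ × ℝ) :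
    latticeSymbol (Real.sin (ω * a₁))⁻¹ (Real.sin (ω * a₂))⁻¹ (2 * gB a₁ a₂ a₃ β ω) p =
      -2 * (phiB a₃ β ω - fFun a₁ a₂ p.1 p.2 ω) := by
  simp only [latticeSymbol, gB, fFun]
  ring

lemma IB_eq_latticeGreen (a₁ a₂ a₃ β ω : ℝ) :
    (IB a₁ a₂ a₃ β ω : ℂ) = -2 * phiB a₃ β ω *
      latticeGreen (Real.sin (ω * a₁))⁻¹ (Real.sin (ω * a₂))⁻¹ (2 * gB a₁ a₂ a₃ β ω) 0 := by
  have h (p : ℝ × ℝ) : phiB a₃ β ω / (phiB a₃ β ω - fFun a₁ a₂ p.1 p.2 ω) =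
      -2 * phiB a₃ β ω * (-2 * (phiB a₃ β ω - fFun a₁ a₂ p.1 p.2 ω))⁻¹ := by
    rw [mul_inv]
    ring
  simp only [IB, latticeGreen, latticeSymbol_eq, h, integral_const_mul]
  simp only [squareChar, Prod.fst_zero, Prod.snd_zero, Int.cast_zero, zero_mul, Complex.exp_zero,
    one_mul, integral_complex_ofReal, fourierSquare]
  push_cast
  ring

lemma satisfiesFD_iff (a₁ a₂ a₃ β μ ω : ℝ) (u : ℤ × ℤ → ℂ) :
    SatisfiesFD a₁ a₂ a₃ β μ ω u ↔
      latticeOp ((Real.sin (ω * a₁))⁻¹ : ℝ) ((Real.sin (ω * a₂))⁻¹ : ℝ)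
        (2 * gB a₁ a₂ a₃ β ω : ℝ) u = Pi.single 0 (2 * ((μ - 1 : ℝ) : ℂ) * phiB a₃ β ω * u 0) := by
  have hop (k l : ℤ) : latticeOp ((Real.sin (ω * a₁))⁻¹ : ℝ) ((Real.sin (ω * a₂))⁻¹ : ℝ)
        (2 * gB a₁ a₂ a₃ β ω : ℝ) u (k, l) =
      u (k + 1, l) / (Real.sin (ω * a₁) : ℂ) + u (k - 1, l) / (Real.sin (ω * a₁) : ℂ)
      + u (k, l + 1) / (Real.sin (ω * a₂) : ℂ) + u (k, l - 1) / (Real.sin (ω * a₂) : ℂ)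
      - 2 * (gB a₁ a₂ a₃ β ω : ℂ) * u (k, l) := by
    simp only [latticeOp, Prod.mk_add_mk, add_zero, ← sub_eq_add_neg]
    push_cast
    ring
  have h0 := hop 0 0
  simp only [zero_add, zero_sub] at h0
  constructor
  · rintro ⟨h1, h2⟩
    funext ⟨k, l⟩
    by_cases hkl : (k, l) = ((0 : ℤ), (0 : ℤ))
    · rw [hkl, h0, h2, ← Prod.zero_eq_mk, Pi.single_eq_same]
    · rw [hop, h1 k l hkl, Pi.single_eq_of_ne (by exact hkl)]
  · intro h
    refine ⟨fun k l hkl => ?_, ?_⟩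
    · rw [← hop, h, Pi.single_eq_of_ne (by exact hkl)]
    · rw [← h0, h, ← Prod.zero_eq_mk, Pi.single_eq_same]

/-- existence of a nontrivial square-summable solution of (FD)
iff `(1 − μ) I_β(ω) = 1`, i.e. `μ = 1 − F_β(ω)`. -/
theorem stmt6 (a₁ a₂ a₃ β μ : ℝ) (ha₁ : 0 < a₁) (ha₂ : 0 < a₂) (ha₃ : 0 < a₃)
    (hβ : β ∈ Icc (0 : ℝ) π) (hμ : 0 < μ) (hμ1 : μ ≠ 1) (ω : ℝ) (hω : 0 < ω)
    (hs1 : Real.sin (ω * a₁) ≠ 0) (hs2 : Real.sin (ω * a₂) ≠ 0)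
    (hs3 : Real.sin (ω * a₃) ≠ 0)
    (hnv : ∀ ξ ∈ Icc (0 : ℝ) (2 * π), ∀ η ∈ Icc (0 : ℝ) (2 * π),
      phiB a₃ β ω - fFun a₁ a₂ ξ η ω ≠ 0) :
    (∃ u : ℤ × ℤ → ℂ, (Summable fun p : ℤ × ℤ => ‖u p‖ ^ 2) ∧ u ≠ 0 ∧
        SatisfiesFD a₁ a₂ a₃ β μ ω u) ↔
      (1 - μ) * IB a₁ a₂ a₃ β ω = 1 ∧ μ = 1 - FB a₁ a₂ a₃ β ω := by
  set a : ℝ := (Real.sin (ω * a₁))⁻¹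
  set b : ℝ := (Real.sin (ω * a₂))⁻¹
  set c : ℝ := 2 * gB a₁ a₂ a₃ β ω
  have hsym : ∀ ξ ∈ Icc (0 : ℝ) (2 * π), ∀ η ∈ Icc (0 : ℝ) (2 * π),
      latticeSymbol a b c (ξ, η) ≠ 0 := fun ξ hξ η hη => by
    rw [latticeSymbol_eq]
    exact mul_ne_zero (by norm_num) (hnv ξ hξ η hη)
  have hG := summable_sq_latticeGreen hsym
  have hGop := latticeOp_latticeGreen hsym
  have hI : (IB a₁ a₂ a₃ β ω : ℂ) = -2 * phiB a₃ β ω * latticeGreen a b c 0 :=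
    IB_eq_latticeGreen a₁ a₂ a₃ β ω
  have hF (h : (1 - μ) * IB a₁ a₂ a₃ β ω = 1) : μ = 1 - FB a₁ a₂ a₃ β ω := by
    rw [FB, ← eq_inv_of_mul_eq_one_left h]
    ring
  have hcast : (1 - μ) * IB a₁ a₂ a₃ β ω = 1 ↔
      2 * ((μ - 1 : ℝ) : ℂ) * phiB a₃ β ω * latticeGreen a b c 0 = 1 := by
    rw [← Complex.ofReal_inj]
    push_cast
    rw [hI]
    constructor <;> intro h <;> linear_combination h
  constructor
  · rintro ⟨u, hu, hu0, hFD⟩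
    have hrep := eq_mul_of_latticeOp_eq_single hu hG hGop ((satisfiesFD_iff ..).mp hFD)
    have hu00 : u 0 ≠ 0 := fun h0 => hu0 <| funext fun p => by simp [hrep p, h0]
    have h := (hcast.mpr <| mul_right_cancel₀ hu00 <| by
      have h0 := hrep 0
      rw [neg_zero] at h0
      linear_combination -h0)
    exact ⟨h, hF h⟩
  · rintro ⟨h, -⟩
    have h1 := hcast.mp h
    refine ⟨latticeGreen a b c, hG, fun h0 => ?_, ?_⟩
    · simp [h0] at h1
    · rw [satisfiesFD_iff, h1]
      exact hGop
end
end

section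
/- Let a₁, a₂, a₃ > 0 and β ∈ [0, π], and let (ω_b, ω_t) be a gap of Σ(β) of type (i) with distinguished point ω₀ ∈ (ω_b, ω_t) ∩ 𝒲(β). Then F_β(ω) → 0 as ω → ω_b from the right with ω ∈ (ω_b, ω₀), and F_β(ω) → 0 as ω → ω_t from the left with ω ∈ (ω₀, ω_t). -/
open Real MeasureTheory Set Filter Topology

noncomputable section

lemma abs_cos_sub_cos_le_of_sin_eq_zero {x₀ : ℝ} (h : Real.sin x₀ = 0) (x : ℝ) :
    |Real.cos x₀ - Real.cos x| ≤ (x - x₀) ^ 2 / 2 := by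
  have hx : Real.cos x = Real.cos x₀ * Real.cos (x - x₀) := by
    conv_lhs => rw [show x = x₀ + (x - x₀) by ring, Real.cos_add, h]
    ring
  have h1 : |Real.cos x₀| = 1 := by
    rcases (Real.sin_eq_zero_iff_cos_eq).1 h with h | h <;> simp [h]
  have h2 := Real.one_sub_sq_div_two_le_cos (x := x - x₀)
  rw [hx, ← mul_one_sub, abs_mul, h1, one_mul, abs_of_nonneg (by linarith [Real.cos_le_one (x - x₀)])]
  linarith

/-- The linear function `t * cos` attains its maximum `|t|` at `0` or at `π`. -/
lemma exists_mul_cos_eq_abs (t : ℝ) :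
    ∃ x₀ : ℝ, 0 ≤ x₀ ∧ x₀ + 1 ≤ 2 * π ∧ Real.sin x₀ = 0 ∧ t * Real.cos x₀ = |t| := by
  have := Real.pi_gt_three
  rcases le_total 0 t with h | h
  · exact ⟨0, le_rfl, by linarith, by simp, by simp [abs_of_nonneg h]⟩
  · exact ⟨π, by linarith, by linarith, by simp, by simp [abs_of_nonpos h]⟩

lemma mul_cos_le_abs (t x : ℝ) : t * Real.cos x ≤ |t| := by
  calc t * Real.cos x ≤ |t * Real.cos x| := le_abs_self _
    _ = |t| * |Real.cos x| := abs_mul _ _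
    _ ≤ |t| * 1 := by gcongr; exact Real.abs_cos_le_one x
    _ = |t| := mul_one _

lemma mul_cos_lt_abs {t x : ℝ} (ht : t ≠ 0) (hx : Real.sin x ≠ 0) : t * Real.cos x < |t| := by
  have h1 : |Real.cos x| < 1 := by
    rw [← sq_lt_one_iff_abs_lt_one]
    have := sq_pos_of_ne_zero hx
    linarith [Real.sin_sq_add_cos_sq x]
  calc t * Real.cos x ≤ |t * Real.cos x| := le_abs_self _
    _ = |t| * |Real.cos x| := abs_mul _ _
    _ < |t| * 1 := by gcongr
    _ = |t| := mul_one _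

lemma integral_div_add_sq {m δ K : ℝ} (hδ : 0 < δ) (hK : 0 < K) (x₀ : ℝ) :
    ∫ x in x₀..(x₀ + 1), m * (x - x₀) / (δ + 2 * K * (x - x₀) ^ 2)
      = m / (4 * K) * (Real.log (δ + 2 * K) - Real.log δ) := by
  have hpos : ∀ x : ℝ, 0 < δ + 2 * K * (x - x₀) ^ 2 := fun x => by positivity
  have hder : ∀ x ∈ uIcc x₀ (x₀ + 1),
      HasDerivAt (fun x => m / (4 * K) * Real.log (δ + 2 * K * (x - x₀) ^ 2))
        (m * (x - x₀) / (δ + 2 * K * (x - x₀) ^ 2)) x := by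
    intro x _
    have h1 : HasDerivAt (fun x : ℝ => δ + 2 * K * (x - x₀) ^ 2)
        (2 * K * (2 * (x - x₀))) x := by
      have := (((hasDerivAt_id x).sub_const x₀).pow 2).const_mul (2 * K) |>.const_add δ
      simpa using this
    refine ((h1.log (hpos x).ne').const_mul (m / (4 * K))).congr_deriv ?_
    have := (hpos x).ne'
    field_simp
    ring
  rw [intervalIntegral.integral_eq_sub_of_hasDerivAt hder]
  · simp [mul_sub]
  · apply Continuous.intervalIntegrable
    exact Continuous.div (by fun_prop) (by fun_prop) fun x => (hpos x).ne'

/-- A logarithmic lower bound for the integral over a unit square of a nearly singular kernel. -/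
lemma log_le_integral_unit_square {m δ K : ℝ} (hm : 0 < m) (hδ : 0 < δ) (hK : 0 < K) (x₀ y₀ : ℝ) :
    m / (4 * K) * (Real.log (δ + 2 * K) - Real.log δ) ≤
      ∫ p in (Ioc x₀ (x₀ + 1)) ×ˢ (Ioc y₀ (y₀ + 1)),
        m / (δ + K * ((p.1 - x₀) ^ 2 + (p.2 - y₀) ^ 2)) := by
  have hpos : ∀ p : ℝ × ℝ, 0 < δ + K * ((p.1 - x₀) ^ 2 + (p.2 - y₀) ^ 2) := fun p => by positivity
  have hcont : Continuous
      fun p : ℝ × ℝ => m / (δ + K * ((p.1 - x₀) ^ 2 + (p.2 - y₀) ^ 2)) :=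
    Continuous.div (by fun_prop) (by fun_prop) fun p => (hpos p).ne'
  have hint : IntegrableOn (fun p : ℝ × ℝ => m / (δ + K * ((p.1 - x₀) ^ 2 + (p.2 - y₀) ^ 2)))
      ((Ioc x₀ (x₀ + 1)) ×ˢ (Ioc y₀ (y₀ + 1))) (volume.prod volume) :=
    (hcont.continuousOn.integrableOn_compact
      (μ := volume.prod volume) (isCompact_Icc.prod isCompact_Icc)).mono_set
      (prod_mono Ioc_subset_Icc_self Ioc_subset_Icc_self)
  rw [Measure.volume_eq_prod, setIntegral_prod _ hint, ← integral_div_add_sq hδ hK x₀,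
    intervalIntegral.integral_of_le (by linarith)]
  apply setIntegral_mono_on _ _ measurableSet_Ioc
  · intro x hx
    have hx0 : 0 < x - x₀ := by linarith [hx.1]
    have hx1 : x - x₀ ≤ 1 := by linarith [hx.2]
    have hcy : Continuous fun y : ℝ => m / (δ + K * ((x - x₀) ^ 2 + (y - y₀) ^ 2)) :=
      hcont.comp (by fun_prop : Continuous fun y : ℝ => (x, y))
    have hiy : IntegrableOn (fun y : ℝ => m / (δ + K * ((x - x₀) ^ 2 + (y - y₀) ^ 2)))
        (Ioc y₀ (y₀ + 1)) :=
      (hcy.continuousOn.integrableOn_compact isCompact_Icc).mono_set Ioc_subset_Icc_self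
    have hsub : Ioc y₀ (y₀ + (x - x₀)) ⊆ Ioc y₀ (y₀ + 1) := Ioc_subset_Ioc_right (by linarith)
    calc m * (x - x₀) / (δ + 2 * K * (x - x₀) ^ 2)
        = ∫ _ in Ioc y₀ (y₀ + (x - x₀)), m / (δ + 2 * K * (x - x₀) ^ 2) := by
          rw [setIntegral_const]
          simp [hx0.le]
          ring
      _ ≤ ∫ y in Ioc y₀ (y₀ + (x - x₀)), m / (δ + K * ((x - x₀) ^ 2 + (y - y₀) ^ 2)) := by
          apply setIntegral_mono_on (by simp) (hiy.mono_set hsub) measurableSet_Ioc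
          intro y hy
          have hy0 : 0 < y - y₀ := by linarith [hy.1]
          have hy1 : (y - y₀) ^ 2 ≤ (x - x₀) ^ 2 := by
            have : y - y₀ ≤ x - x₀ := by linarith [hy.2]
            gcongr
          apply div_le_div_of_nonneg_left hm.le (hpos (x, y))
          nlinarith
      _ ≤ _ := by
          apply setIntegral_mono_set hiy _ hsub.eventuallyLE
          exact Eventually.of_forall fun y => div_nonneg hm.le (hpos (x, y)).le
  · apply IntegrableOn.mono_set _ Ioc_subset_Icc_self
    apply ContinuousOn.integrableOn_compact isCompact_Icc
    exact (Continuous.div (by fun_prop) (by fun_prop)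
      fun x => (by positivity : 0 < δ + 2 * K * (x - x₀) ^ 2).ne').continuousOn
  · exact Integrable.integral_prod_left (by rwa [IntegrableOn, ← Measure.prod_restrict] at hint)

lemma continuous_fFun (a₁ a₂ ω : ℝ) : Continuous fun p : ℝ × ℝ => fFun a₁ a₂ p.1 p.2 ω := by
  unfold fFun
  fun_prop

lemma Dfun_eq_mul {a₁ a₂ a₃ β ω : ℝ} (h₁ : Real.sin (ω * a₁) ≠ 0) (h₂ : Real.sin (ω * a₂) ≠ 0)
    (h₃ : Real.sin (ω * a₃) ≠ 0) (ξ η : ℝ) :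
    Dfun a₁ a₂ a₃ β ω ξ η = Real.sin (ω * a₁) * Real.sin (ω * a₂) * Real.sin (ω * a₃) *
      (phiB a₃ β ω - fFun a₁ a₂ ξ η ω) := by
  simp only [Dfun, phiB, fFun]
  field_simp
  ring

lemma tendsto_fFun {a₁ a₂ e : ℝ} (h₁ : Real.sin (e * a₁) ≠ 0) (h₂ : Real.sin (e * a₂) ≠ 0)
    (ξ η : ℝ) (J : Set ℝ) :
    Tendsto (fun ω => fFun a₁ a₂ ξ η ω) (𝓝[J] e) (𝓝 (fFun a₁ a₂ ξ η e)) := by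
  have : ContinuousAt (fun ω => fFun a₁ a₂ ξ η ω) e := by
    unfold fFun
    fun_prop (disch := assumption)
  exact this.tendsto.mono_left nhdsWithin_le_nhds

/-- `φ_β` tends to zero at a removable singularity. -/
lemma tendsto_phiB_zero {a₃ β e : ℝ} (h₃ : Real.sin (e * a₃) = 0)
    (hc : Real.cos (e * a₃) = Real.cos β) {J : Set ℝ} (hJ : ∀ ω ∈ J, Real.sin (ω * a₃) ≠ 0) :
    Tendsto (phiB a₃ β) (𝓝[J] e) (𝓝 0) := by
  have hsq : Real.cos β ^ 2 = 1 := by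
    rw [← hc]
    nlinarith [Real.sin_sq_add_cos_sq (e * a₃)]
  have hne : Real.cos (e * a₃) + Real.cos β ≠ 0 := by
    intro h
    rw [hc] at h
    nlinarith
  have hcont : ContinuousAt
      (fun ω => -Real.sin (ω * a₃) / (Real.cos (ω * a₃) + Real.cos β)) e := by
    fun_prop (disch := assumption)
  have hlim := hcont.tendsto.mono_left (nhdsWithin_le_nhds (s := J))
  rw [h₃, neg_zero, zero_div] at hlim
  refine hlim.congr' ?_
  filter_upwards [self_mem_nhdsWithin] with ω hω
  have hs := hJ ω hω
  have hsc := Real.sin_sq_add_cos_sq (ω * a₃)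
  have hn : Real.cos (ω * a₃) + Real.cos β ≠ 0 := by
    intro h
    have : Real.cos (ω * a₃) = -Real.cos β := by linarith
    rw [this] at hsc
    have := sq_pos_of_ne_zero hs
    nlinarith
  rw [phiB, div_eq_div_iff hn hs]
  nlinarith

/-- If `s (φ_β - f) > 0` and it vanishes somewhere at the endpoint, then `F_β → 0` there. -/
lemma tendsto_FB_zero {a₁ a₂ a₃ β s e k₁ k₂ : ℝ} {J : Set ℝ} (hs : s ≠ 0) [NeBot (𝓝[J] e)]
    (h₁ : Real.sin (e * a₁) ≠ 0) (h₂ : Real.sin (e * a₂) ≠ 0)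
    (hJ₃ : ∀ ω ∈ J, Real.sin (ω * a₃) ≠ 0)
    (hJ : ∀ ω ∈ J, ∀ ξ η, 0 < s * (phiB a₃ β ω - fFun a₁ a₂ ξ η ω))
    (hD : Dfun a₁ a₂ a₃ β e k₁ k₂ = 0) :
    Tendsto (fun ω => FB a₁ a₂ a₃ β ω) (𝓝[J] e) (𝓝 0) := by
  obtain ⟨ξ₀, hξ0, hξ1, hξs, hξ⟩ := exists_mul_cos_eq_abs (s / Real.sin (e * a₁))
  obtain ⟨η₀, hη0, hη1, hηs, hη⟩ := exists_mul_cos_eq_abs (s / Real.sin (e * a₂))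
  have expand : ∀ ξ η, s * fFun a₁ a₂ ξ η e =
      s / Real.sin (e * a₁) * Real.cos ξ - s / Real.sin (e * a₁) * Real.cos (e * a₁)
        + (s / Real.sin (e * a₂) * Real.cos η - s / Real.sin (e * a₂) * Real.cos (e * a₂)) := by
    intro ξ η
    simp only [fFun]
    ring
  have fpos : 0 < s * fFun a₁ a₂ ξ₀ η₀ e := by
    rw [expand, hξ, hη]
    linarith [mul_cos_lt_abs (div_ne_zero hs h₁) h₁, mul_cos_lt_abs (div_ne_zero hs h₂) h₂]
  have fmax : ∀ ξ η, s * fFun a₁ a₂ ξ η e ≤ s * fFun a₁ a₂ ξ₀ η₀ e := by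
    intro ξ η
    rw [expand, expand, hξ, hη]
    linarith [mul_cos_le_abs (s / Real.sin (e * a₁)) ξ, mul_cos_le_abs (s / Real.sin (e * a₂)) η]
  have flim := (tendsto_fFun h₁ h₂ ξ₀ η₀ J).const_mul s
  have hle : ∀ ω ∈ J, s * fFun a₁ a₂ ξ₀ η₀ ω ≤ s * phiB a₃ β ω := fun ω hω => by
    linarith [hJ ω hω ξ₀ η₀]
  have h₃ : Real.sin (e * a₃) ≠ 0 := by
    intro h₃
    have hc : Real.cos (e * a₃) = Real.cos β := by
      simp only [Dfun, h₃, mul_zero, zero_mul, zero_add, mul_eq_zero, h₁, h₂, false_or] at hD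
      linarith
    have hlim := (tendsto_phiB_zero h₃ hc hJ₃).const_mul s
    have := le_of_tendsto_of_tendsto flim hlim
      (eventually_of_mem self_mem_nhdsWithin hle)
    linarith
  have philim : Tendsto (fun ω => s * phiB a₃ β ω) (𝓝[J] e) (𝓝 (s * phiB a₃ β e)) := by
    have : ContinuousAt (phiB a₃ β) e := by
      unfold phiB
      fun_prop (disch := assumption)
    exact (this.tendsto.mono_left nhdsWithin_le_nhds).const_mul s
  have htouch : s * phiB a₃ β e = s * fFun a₁ a₂ ξ₀ η₀ e := by
    apply le_antisymm
    · rw [Dfun_eq_mul h₁ h₂ h₃] at hD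
      have : phiB a₃ β e = fFun a₁ a₂ k₁ k₂ e := by
        simpa [h₁, h₂, h₃, sub_eq_zero] using hD
      rw [this]
      exact fmax _ _
    · exact le_of_tendsto_of_tendsto flim philim (eventually_of_mem self_mem_nhdsWithin hle)
  set δ : ℝ → ℝ := fun ω => s * phiB a₃ β ω - s * fFun a₁ a₂ ξ₀ η₀ ω with hδ_def
  have δlim : Tendsto δ (𝓝[J] e) (𝓝[>] 0) := by
    refine tendsto_nhdsWithin_iff.2 ⟨?_, ?_⟩
    · have := philim.sub flim
      rwa [htouch, sub_self] at this
    · filter_upwards [self_mem_nhdsWithin] with ω hω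
      have := hJ ω hω ξ₀ η₀
      simp only [hδ_def, Set.mem_Ioi]
      linarith
  set m := s * phiB a₃ β e / 2 with hm_def
  have hm : 0 < m := by rw [hm_def, htouch]; linarith
  obtain ⟨K, hKpos, hK₁, hK₂⟩ : ∃ K : ℝ, 0 < K ∧ |s / Real.sin (e * a₁)| < K ∧
      |s / Real.sin (e * a₂)| < K := by
    refine ⟨|s / Real.sin (e * a₁)| + |s / Real.sin (e * a₂)| + 1, by positivity, ?_, ?_⟩ <;>
      linarith [abs_nonneg (s / Real.sin (e * a₁)), abs_nonneg (s / Real.sin (e * a₂))]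
  have coef : ∀ a : ℝ, Real.sin (e * a) ≠ 0 → |s / Real.sin (e * a)| < K →
      ∀ᶠ ω in 𝓝[J] e, |s / Real.sin (ω * a)| < K := by
    intro a ha hlt
    have : ContinuousAt (fun ω => |s / Real.sin (ω * a)|) e := by
      fun_prop (disch := assumption)
    exact (this.tendsto.mono_left nhdsWithin_le_nhds).eventually (gt_mem_nhds hlt)
  have bound : ∀ᶠ ω in 𝓝[J] e, 1 / (4 * π ^ 2) *
      (m / (4 * K) * (Real.log (2 * K) - Real.log (δ ω))) ≤ IB a₁ a₂ a₃ β ω := by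
    filter_upwards [self_mem_nhdsWithin, coef a₁ h₁ hK₁, coef a₂ h₂ hK₂,
      philim.eventually (lt_mem_nhds (show m < s * phiB a₃ β e by linarith)),
      δlim.eventually self_mem_nhdsWithin] with ω hω c₁ c₂ hφ hδ
    have hδ : 0 < δ ω := hδ
    have hne : ∀ p : ℝ × ℝ, phiB a₃ β ω - fFun a₁ a₂ p.1 p.2 ω ≠ 0 := fun p h => by
      have := hJ ω hω p.1 p.2
      simp [h] at this
    have hcont : Continuous
        fun p : ℝ × ℝ => phiB a₃ β ω / (phiB a₃ β ω - fFun a₁ a₂ p.1 p.2 ω) :=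
      continuous_const.div (continuous_const.sub (continuous_fFun a₁ a₂ ω)) hne
    have heq : ∀ p : ℝ × ℝ, phiB a₃ β ω / (phiB a₃ β ω - fFun a₁ a₂ p.1 p.2 ω) =
        (s * phiB a₃ β ω) / (s * (phiB a₃ β ω - fFun a₁ a₂ p.1 p.2 ω)) := fun p =>
      (mul_div_mul_left _ _ hs).symm
    have hnonneg : ∀ p : ℝ × ℝ, 0 ≤ phiB a₃ β ω / (phiB a₃ β ω - fFun a₁ a₂ p.1 p.2 ω) := by
      intro p
      rw [heq]
      exact div_nonneg (by linarith) (hJ ω hω _ _).le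
    have hlow : ∀ p : ℝ × ℝ, m / (δ ω + K * ((p.1 - ξ₀) ^ 2 + (p.2 - η₀) ^ 2)) ≤
        phiB a₃ β ω / (phiB a₃ β ω - fFun a₁ a₂ p.1 p.2 ω) := by
      intro p
      rw [heq]
      have hterm : ∀ {t d q : ℝ}, |t| < K → |d| ≤ q / 2 → t * d ≤ K * (q / 2) := by
        intro t d q ht hd
        calc t * d ≤ |t * d| := le_abs_self _
          _ = |t| * |d| := abs_mul _ _
          _ ≤ K * (q / 2) := by gcongr
      have e1 := hterm c₁ (abs_cos_sub_cos_le_of_sin_eq_zero hξs p.1)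
      have e2 := hterm c₂ (abs_cos_sub_cos_le_of_sin_eq_zero hηs p.2)
      have e3 : s * (phiB a₃ β ω - fFun a₁ a₂ p.1 p.2 ω) = δ ω +
          s / Real.sin (ω * a₁) * (Real.cos ξ₀ - Real.cos p.1) +
          s / Real.sin (ω * a₂) * (Real.cos η₀ - Real.cos p.2) := by
        simp only [hδ_def, fFun]
        ring
      apply div_le_div₀ (by linarith) hφ.le (hJ ω hω _ _)
      rw [e3]
      have := mul_nonneg hKpos.le (sq_nonneg (p.1 - ξ₀))
      have := mul_nonneg hKpos.le (sq_nonneg (p.2 - η₀))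
      nlinarith
    rw [IB]
    gcongr
    have hint : IntegrableOn
        (fun p : ℝ × ℝ => phiB a₃ β ω / (phiB a₃ β ω - fFun a₁ a₂ p.1 p.2 ω))
        (Ioc 0 (2 * π) ×ˢ Ioc 0 (2 * π)) :=
      (hcont.continuousOn.integrableOn_compact (isCompact_Icc.prod isCompact_Icc)).mono_set
        (prod_mono Ioc_subset_Icc_self Ioc_subset_Icc_self)
    have hsub := prod_mono (Ioc_subset_Ioc hξ0 hξ1) (Ioc_subset_Ioc hη0 hη1)
    have hae : (Ioo (0 : ℝ) (2 * π) ×ˢ Ioo (0 : ℝ) (2 * π) : Set (ℝ × ℝ)) =ᵐ[volume]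
        (Ioc (0 : ℝ) (2 * π) ×ˢ Ioc (0 : ℝ) (2 * π) : Set (ℝ × ℝ)) := by
      rw [Measure.volume_eq_prod]
      exact Measure.set_prod_ae_eq Ioo_ae_eq_Ioc Ioo_ae_eq_Ioc
    rw [setIntegral_congr_set hae]
    calc m / (4 * K) * (Real.log (2 * K) - Real.log (δ ω))
        ≤ m / (4 * K) * (Real.log (δ ω + 2 * K) - Real.log (δ ω)) := by
          gcongr
          linarith
      _ ≤ _ := log_le_integral_unit_square hm hδ hKpos ξ₀ η₀
      _ ≤ ∫ p in (Ioc ξ₀ (ξ₀ + 1)) ×ˢ (Ioc η₀ (η₀ + 1)),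
            phiB a₃ β ω / (phiB a₃ β ω - fFun a₁ a₂ p.1 p.2 ω) := by
          refine integral_mono_of_nonneg (Eventually.of_forall fun p => ?_) (hint.mono_set hsub)
            (Eventually.of_forall hlow)
          exact div_nonneg hm.le (by positivity)
      _ ≤ _ := setIntegral_mono_set hint (Eventually.of_forall hnonneg) hsub.eventuallyLE
  have logdiv : Tendsto (fun ω => 1 / (4 * π ^ 2) *
      (m / (4 * K) * (Real.log (2 * K) - Real.log (δ ω)))) (𝓝[J] e) atTop := by
    apply Tendsto.const_mul_atTop (by positivity)
    apply Tendsto.const_mul_atTop (by positivity)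
    simp_rw [sub_eq_add_neg]
    exact tendsto_atTop_add_const_left _ _
      (tendsto_neg_atBot_atTop.comp (Real.tendsto_log_nhdsGT_zero.comp δlim))
  exact (tendsto_atTop_mono' _ bound logdiv).inv_tendsto_atTop

lemma sin_mul_ne_zero_of_notMem {a e : ℝ} (ha : 0 < a) (he : 0 < e)
    (h : ∀ n : ℕ, 1 ≤ n → e ≠ π * n / a) : Real.sin (e * a) ≠ 0 := by
  intro hs
  obtain ⟨n, hn⟩ := Real.sin_eq_zero_iff.1 hs
  have hpos : 0 < (n : ℝ) * π := by rw [hn]; positivity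
  have hn0 : 0 < n := by exact_mod_cast pos_of_mul_pos_left hpos Real.pi_pos.le
  lift n to ℕ using hn0.le
  apply h n (by omega)
  rw [eq_div_iff ha.ne', ← hn]
  push_cast
  ring

lemma mem_dispSet_of_Dfun_eq_zero {a₁ a₂ a₃ β ω ξ η : ℝ} (hω : 0 < ω)
    (h : Dfun a₁ a₂ a₃ β ω ξ η = 0) : ω ∈ dispSet a₁ a₂ a₃ β := by
  refine ⟨hω, Real.arccos (Real.cos ξ), ⟨Real.arccos_nonneg _, Real.arccos_le_pi _⟩,
    Real.arccos (Real.cos η), ⟨Real.arccos_nonneg _, Real.arccos_le_pi _⟩, ?_⟩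
  unfold Dfun at *
  rwa [Real.cos_arccos (Real.neg_one_le_cos _) (Real.cos_le_one _),
    Real.cos_arccos (Real.neg_one_le_cos _) (Real.cos_le_one _)]

/-- Every point of `𝒲(β)` is a pole of `φ_β`, and consecutive zeros of `sin(ω a₃)` lie either in
`𝒲(β)` or at a zero of `D_β`. -/
lemma Wset_spec {a₃ β ω₀ : ℝ} (ha₃ : 0 < a₃) (hβ : β ∈ Icc (0 : ℝ) π) (h : ω₀ ∈ Wset a₃ β) :
    Real.sin (ω₀ * a₃) = 0 ∧ 0 < 1 - Real.cos (ω₀ * a₃) * Real.cos β ∧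
      ((∀ ω : ℝ, 0 < ω → (ω = ω₀ - π / a₃ ∨ ω = ω₀ + π / a₃) → ω ∈ Wset a₃ β) ∨
        Real.cos β = -Real.cos (ω₀ * a₃)) := by
  by_cases hb : β = 0 ∨ β = π
  · rw [Wset, if_pos hb] at h
    obtain ⟨n, -, rfl⟩ := h
    have hx : (β / a₃ + (2 * n + 1) * π / a₃) * a₃ = (β + π) + n * (2 * π) := by
      field_simp
      ring
    have hsin : Real.sin β = 0 := by rcases hb with rfl | rfl <;> simp
    have hcos : Real.cos β * Real.cos β = 1 := by rcases hb with rfl | rfl <;> simp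
    rw [hx, Real.sin_add_nat_mul_two_pi, Real.cos_add_nat_mul_two_pi, Real.sin_add_pi,
      Real.cos_add_pi]
    refine ⟨by simp [hsin], by nlinarith, Or.inr (by simp)⟩
  · rw [Wset, if_neg hb] at h
    obtain ⟨n, hn, rfl⟩ := h
    have hx : π * n / a₃ * a₃ = n * π := by
      field_simp
    have hs : Real.sin β ≠ 0 := by
      push Not at hb
      exact (Real.sin_pos_of_pos_of_lt_pi (lt_of_le_of_ne hβ.1 hb.1.symm)
        (lt_of_le_of_ne hβ.2 hb.2)).ne'
    rw [hx]
    have hsn : Real.sin (n * π) = 0 := Real.sin_nat_mul_pi n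
    have habs : |Real.cos (n * π)| = 1 := Real.abs_cos_eq_one_iff.2 ⟨n, by simp⟩
    refine ⟨hsn, ?_, Or.inl ?_⟩
    · have := mul_cos_lt_abs (t := Real.cos (n * π)) (by intro h0; simp [h0] at habs) hs
      linarith
    · rintro ω hω (rfl | rfl)
      · rw [Wset, if_neg hb]
        have hlt : 0 < π / a₃ * ((n : ℝ) - 1) := by
          convert hω using 1
          ring
        have hn1 : (1 : ℝ) < n := by
          have := pos_of_mul_pos_right hlt (by positivity)
          linarith
        have hn2 : 1 < n := by exact_mod_cast hn1
        refine ⟨n - 1, by omega, ?_⟩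
        rw [Nat.cast_sub hn]
        push_cast
        ring
      · rw [Wset, if_neg hb]
        refine ⟨n + 1, by omega, ?_⟩
        push_cast
        ring

/-- in a gap of type (i), `F_β → 0` at both ends of the gap. -/
theorem stmt9 (a₁ a₂ a₃ β : ℝ) (ha₁ : 0 < a₁) (ha₂ : 0 < a₂) (ha₃ : 0 < a₃)
    (hβ : β ∈ Icc (0 : ℝ) π) (ωb ωt ω₀ : ℝ) (hgap : IsGap a₁ a₂ a₃ β ωb ωt)
    (hb : ωb ∉ Tset a₁ a₂) (ht : ωt ∉ Tset a₁ a₂)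
    (hω₀ : ω₀ ∈ Ioo ωb ωt ∩ Wset a₃ β)
    (huniq : ∀ ω ∈ Ioo ωb ωt ∩ Wset a₃ β, ω = ω₀) :
    Tendsto (fun ω => FB a₁ a₂ a₃ β ω) (𝓝[Ioo ωb ω₀] ωb) (𝓝 0) ∧
    Tendsto (fun ω => FB a₁ a₂ a₃ β ω) (𝓝[Ioo ω₀ ωt] ωt) (𝓝 0) := by
  obtain ⟨hb0, hbt, ⟨-, kb₁, -, kb₂, -, hDb⟩, ⟨ht0, kt₁, -, kt₂, -, hDt⟩, hempty⟩ := hgap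
  obtain ⟨⟨hbω, hωt⟩, hW⟩ := hω₀
  obtain ⟨hs₀, hc₀, hnext⟩ := Wset_spec ha₃ hβ hW
  have hnot : ∀ ω ∈ Ioo ωb ωt, ∀ ξ η, Dfun a₁ a₂ a₃ β ω ξ η ≠ 0 := by
    intro ω hω ξ η h
    have : ω ∈ Ioo ωb ωt ∩ dispSet a₁ a₂ a₃ β :=
      ⟨hω, mem_dispSet_of_Dfun_eq_zero (hb0.trans hω.1) h⟩
    simp [hempty] at this
  have hS₁ : ∀ ω ∈ Ioo ωb ωt, Real.sin (ω * a₁) ≠ 0 := fun ω hω h =>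
    hnot ω hω (ω * a₁) 0 (by simp [Dfun, h])
  have hS₂ : ∀ ω ∈ Ioo ωb ωt, Real.sin (ω * a₂) ≠ 0 := fun ω hω h =>
    hnot ω hω 0 (ω * a₂) (by simp [Dfun, h])
  set c := Real.cos (ω₀ * a₃) with hc
  have hcc : c * c = 1 := by
    nlinarith [Real.sin_sq_add_cos_sq (ω₀ * a₃)]
  have hcne : c ≠ 0 := by rintro h; simp [h] at hcc
  have hshift : ∀ ω, Real.sin (ω * a₃) = c * Real.sin ((ω - ω₀) * a₃) := by
    intro ω
    rw [show ω * a₃ = ω₀ * a₃ + (ω - ω₀) * a₃ by ring, Real.sin_add, hs₀]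
    ring
  have hfar : ∀ ω, (ω = ω₀ - π / a₃ ∨ ω = ω₀ + π / a₃) → ω ∉ Ioo ωb ωt := by
    intro ω hω hmem
    rcases hnext with h | h
    · have hne := huniq ω ⟨hmem, h ω (hb0.trans hmem.1) hω⟩
      have : 0 < π / a₃ := by positivity
      rcases hω with hω | hω <;> linarith
    · have hx : ω * a₃ = ω₀ * a₃ - π ∨ ω * a₃ = ω₀ * a₃ + π := by
        rcases hω with rfl | rfl
        · left; field_simp
        · right; field_simp
      apply hnot ω hmem 0 0
      rcases hx with hx | hx <;>
        simp [Dfun, hx, Real.sin_sub_pi, Real.sin_add_pi, Real.cos_sub_pi, Real.cos_add_pi,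
          hs₀, h, ← hc]
  have hperiod : 0 < π / a₃ := by positivity
  have hlo : ω₀ - π / a₃ ≤ ωb := by
    by_contra! h
    exact hfar _ (Or.inl rfl) ⟨h, by linarith⟩
  have hhi : ωt ≤ ω₀ + π / a₃ := by
    by_contra! h
    exact hfar _ (Or.inr rfl) ⟨by linarith, h⟩
  have hsign : ∀ ω ∈ Ioo ωb ωt, ∀ ξ η,
      0 < Dfun a₁ a₂ a₃ β ω ξ η * (Real.sin (ω * a₁) * Real.sin (ω * a₂)) * c := by
    intro ω hω ξ η
    by_contra! hneg
    have hpos : 0 ≤ Dfun a₁ a₂ a₃ β ω₀ ξ η *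
        (Real.sin (ω₀ * a₁) * Real.sin (ω₀ * a₂)) * c := by
      have : Dfun a₁ a₂ a₃ β ω₀ ξ η * (Real.sin (ω₀ * a₁) * Real.sin (ω₀ * a₂)) * c =
          (Real.sin (ω₀ * a₁) * Real.sin (ω₀ * a₂)) ^ 2 * (1 - c * Real.cos β) := by
        simp only [Dfun, hs₀, ← hc]
        linear_combination (Real.sin (ω₀ * a₁) * Real.sin (ω₀ * a₂)) ^ 2 * hcc
      rw [this]
      exact mul_nonneg (sq_nonneg _) hc₀.le
    have hcont : Continuous fun ω => Dfun a₁ a₂ a₃ β ω ξ η *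
        (Real.sin (ω * a₁) * Real.sin (ω * a₂)) * c := by
      unfold Dfun
      fun_prop
    obtain ⟨x, hx, hx0⟩ := isPreconnected_Ioo.intermediate_value hω ⟨hbω, hωt⟩
      hcont.continuousOn ⟨hneg, hpos⟩
    simp [hnot x hx, hS₁ x hx, hS₂ x hx, hcne] at hx0
  have hfactor : ∀ ω ∈ Ioo ωb ωt, Real.sin (ω * a₃) ≠ 0 → ∀ ξ η,
      0 < Real.sin ((ω - ω₀) * a₃) * (phiB a₃ β ω - fFun a₁ a₂ ξ η ω) := by
    intro ω hω h₃ ξ η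
    have h := hsign ω hω ξ η
    rw [Dfun_eq_mul (hS₁ ω hω) (hS₂ ω hω) h₃, hshift] at h
    have h' : 0 < (Real.sin (ω * a₁) * Real.sin (ω * a₂)) ^ 2 *
        (Real.sin ((ω - ω₀) * a₃) * (phiB a₃ β ω - fFun a₁ a₂ ξ η ω)) := by
      convert h using 1
      linear_combination -(Real.sin (ω * a₁) * Real.sin (ω * a₂)) ^ 2 *
        (Real.sin ((ω - ω₀) * a₃) * (phiB a₃ β ω - fFun a₁ a₂ ξ η ω)) * hcc
    exact pos_of_mul_pos_right h' (sq_nonneg _)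
  have hpi : π / a₃ * a₃ = π := by field_simp
  have hleft : ∀ ω ∈ Ioo ωb ω₀, Real.sin ((ω - ω₀) * a₃) < 0 := fun ω hω =>
    Real.sin_neg_of_neg_of_neg_pi_lt (mul_neg_of_neg_of_pos (by linarith [hω.2]) ha₃)
      (by nlinarith [hω.1])
  have hright : ∀ ω ∈ Ioo ω₀ ωt, 0 < Real.sin ((ω - ω₀) * a₃) := fun ω hω =>
    Real.sin_pos_of_pos_of_lt_pi (mul_pos (by linarith [hω.1]) ha₃) (by nlinarith [hω.2])
  have : NeBot (𝓝[Ioo ωb ω₀] ωb) := by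
    rw [nhdsWithin_Ioo_eq_nhdsGT hbω]; infer_instance
  have : NeBot (𝓝[Ioo ω₀ ωt] ωt) := by
    rw [nhdsWithin_Ioo_eq_nhdsLT hωt]; infer_instance
  have hT : ∀ e, 0 < e → e ∉ Tset a₁ a₂ → Real.sin (e * a₁) ≠ 0 ∧ Real.sin (e * a₂) ≠ 0 :=
    fun e he h => ⟨sin_mul_ne_zero_of_notMem ha₁ he fun n hn hx => h (Or.inl ⟨n, hn, hx⟩),
      sin_mul_ne_zero_of_notMem ha₂ he fun n hn hx => h (Or.inr ⟨n, hn, hx⟩)⟩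
  have hJl : ∀ ω ∈ Ioo ωb ω₀, Real.sin (ω * a₃) ≠ 0 := fun ω hω => by
    rw [hshift]; exact mul_ne_zero hcne (hleft ω hω).ne
  have hJr : ∀ ω ∈ Ioo ω₀ ωt, Real.sin (ω * a₃) ≠ 0 := fun ω hω => by
    rw [hshift]; exact mul_ne_zero hcne (hright ω hω).ne'
  constructor
  · refine tendsto_FB_zero (s := -1) (by norm_num) (hT _ hb0 hb).1 (hT _ hb0 hb).2 hJl ?_ hDb
    intro ω hω ξ η
    have := hfactor ω ⟨hω.1, hω.2.trans hωt⟩ (hJl ω hω) ξ η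
    have := neg_of_mul_pos_right this (hleft ω hω).le
    linarith
  · refine tendsto_FB_zero (s := 1) (by norm_num) (hT _ ht0 ht).1 (hT _ ht0 ht).2 hJr ?_ hDt
    intro ω hω ξ η
    have := hfactor ω ⟨hbω.trans hω.1, hω.2⟩ (hJr ω hω) ξ η
    rw [one_mul]
    exact pos_of_mul_pos_right this (hright ω hω).le
end
end
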